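/- arXiv:2511.18064 — 3 statements merged into one kernel-verified Lean document; each statement's English description precedes it below -/
import Mathlib

section
/- Let G be an infinite commutative group and M̄ an upper mean on G with conjugate lower mean M̲(f) = −M̄(−f). Then there exists a functional M₁ on the bounded real functions on G which is simultaneously an upper mean and a lower mean (a full mean; in particular M₁ is additive: M₁(f+g) = M₁(f) + M₁(g)) such that M̲(f) ≤ M₁(f) ≤ M̄(f) for every bounded function f. -/
open scoped Pointwise BigOperators
open Filter

/-- A real function on `G` is bounded. -/
def Bounded {G : Type*} (f : G → ℝ) : Prop :=
  ∃ C : ℝ, ∀ x, |f x| ≤ C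

/-- An upper mean on the bounded real functions on a commutative group `G`. -/
structure IsUpperMean (G : Type*) [AddCommGroup G] (M : (G → ℝ) → ℝ) : Prop where
  norming : ∀ c : ℝ, M (fun _ => c) = c
  mono : ∀ f g : G → ℝ, Bounded f → Bounded g → (∀ x, f x ≤ g x) → M f ≤ M g
  homog : ∀ c : ℝ, 0 ≤ c → ∀ f : G → ℝ, Bounded f → M (fun x => c * f x) = c * M f
  restr_add : ∀ f : G → ℝ, Bounded f → ∀ t : G, M (fun x => f x + f (x + t)) = 2 * M f
  subadd : ∀ f g : G → ℝ, Bounded f → Bounded g → M (fun x => f x + g x) ≤ M f + M g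

/-- A lower mean on the bounded real functions on a commutative group `G`. -/
structure IsLowerMean (G : Type*) [AddCommGroup G] (M : (G → ℝ) → ℝ) : Prop where
  norming : ∀ c : ℝ, M (fun _ => c) = c
  mono : ∀ f g : G → ℝ, Bounded f → Bounded g → (∀ x, f x ≤ g x) → M f ≤ M g
  homog : ∀ c : ℝ, 0 ≤ c → ∀ f : G → ℝ, Bounded f → M (fun x => c * f x) = c * M f
  restr_add : ∀ f : G → ℝ, Bounded f → ∀ t : G, M (fun x => f x + f (x + t)) = 2 * M f
  superadd : ∀ f g : G → ℝ, Bounded f → Bounded g → M f + M g ≤ M (fun x => f x + g x)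

/-- `f` and `f'` are commarginal: marginals of a bounded `F` supported near the diagonal. -/
def Commarginal {G : Type*} [AddCommGroup G] (f f' : G → ℝ) : Prop :=
  ∃ (F : G → G → ℝ) (B : Finset G),
    (∃ C : ℝ, ∀ x y, |F x y| ≤ C) ∧
    (∀ x y, F x y ≠ 0 → x - y ∈ B) ∧
    (∀ x, ∑ᶠ y, F x y = f x) ∧
    (∀ y, ∑ᶠ x, F x y = f' y)

/-- Uniform convergence of a sequence of functions. -/
def UnifLim {G : Type*} (g : ℕ → G → ℝ) (f : G → ℝ) : Prop :=
  ∀ ε : ℝ, 0 < ε → ∃ N : ℕ, ∀ n ≥ N, ∀ x, |g n x - f x| < ε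

/-- `f` and `f'` are limit-commarginal. -/
def LimitCommarginal {G : Type*} [AddCommGroup G] (f f' : G → ℝ) : Prop :=
  ∃ g g' : ℕ → G → ℝ, (∀ n, Bounded (g n)) ∧ (∀ n, Bounded (g' n)) ∧
    (∀ n, Commarginal (g n) (g' n)) ∧ UnifLim g f ∧ UnifLim g' f'

/-- `g` is a finite convex combination of translates of `f`. -/
def ConvexCombTranslates {G : Type*} [AddCommGroup G] (f g : G → ℝ) : Prop :=
  ∃ (n : ℕ) (c : Fin n → ℝ) (t : Fin n → G),
    (∀ i, 0 ≤ c i) ∧ (∑ i, c i) = 1 ∧ ∀ x, g x = ∑ i, c i * f (x + t i)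

/-- The uppermost mean `M*`. -/
noncomputable def Mstar {G : Type*} [AddCommGroup G] (f : G → ℝ) : ℝ :=
  sInf {a : ℝ | ∃ g : G → ℝ, ConvexCombTranslates f g ∧ a = sSup (Set.range g)}

/-- The lowest mean `M_*`. -/
noncomputable def Mlowstar {G : Type*} [AddCommGroup G] (f : G → ℝ) : ℝ :=
  sSup {a : ℝ | ∃ g : G → ℝ, ConvexCombTranslates f g ∧ a = sInf (Set.range g)}

/-- The `B`-average `(f|B)(t)` of `f`. -/
noncomputable def avg {G : Type*} [AddCommGroup G] (f : G → ℝ) (B : Finset G) (t : G) : ℝ :=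
  (∑ b ∈ B, f (b + t)) / (B.card : ℝ)

/-- The expansion pseudomean `E(f)`. -/
noncomputable def Epm {G : Type*} [AddCommGroup G] [DecidableEq G] (f : G → ℝ) : ℝ :=
  ⨅ T : {T : Finset G // T.Nonempty}, ⨆ B : {B : Finset G // B.Nonempty},
    (∑ b ∈ B.1, f b) / (((B.1 + T.1).card : ℝ))

/-- A finite nonempty `Y ⊆ G` is a tile: some set `Z` of translates partitions `G`. -/
def IsTile {G : Type*} [AddCommGroup G] (Y : Finset G) : Prop :=
  Y.Nonempty ∧ ∃ Z : Set G, ∀ x : G, ∃! p : Y × Z, (p.1 : G) + (p.2 : G) = x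

namespace Bounded

variable {G : Type*} {f g : G → ℝ}

lemma const (c : ℝ) : Bounded fun _ : G => c := ⟨|c|, fun _ => le_rfl⟩

lemma add (hf : Bounded f) (hg : Bounded g) : Bounded fun x => f x + g x := by
  obtain ⟨C, hC⟩ := hf
  obtain ⟨D, hD⟩ := hg
  exact ⟨C + D, fun x => (abs_add_le _ _).trans (add_le_add (hC x) (hD x))⟩

lemma const_mul (c : ℝ) (hf : Bounded f) : Bounded fun x => c * f x := by
  obtain ⟨C, hC⟩ := hf
  refine ⟨|c| * C, fun x => ?_⟩
  rw [abs_mul]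
  exact mul_le_mul_of_nonneg_left (hC x) (abs_nonneg c)

lemma neg (hf : Bounded f) : Bounded fun x => -f x := by
  simpa using hf.const_mul (-1)

lemma sub (hf : Bounded f) (hg : Bounded g) : Bounded fun x => f x - g x := by
  simpa only [sub_eq_add_neg] using hf.add hg.neg

lemma translate [AddCommGroup G] (hf : Bounded f) (t : G) : Bounded fun x => f (x + t) := by
  obtain ⟨C, hC⟩ := hf
  exact ⟨C, fun x => hC (x + t)⟩

end Bounded

/-- The real vector space of bounded functions on `G`. -/
def boundedSubmodule (G : Type*) : Submodule ℝ (G → ℝ) where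
  carrier := {f | Bounded f}
  add_mem' hf hg := hf.add hg
  zero_mem' := Bounded.const 0
  smul_mem' c _ hf := hf.const_mul c

namespace IsUpperMean

variable {G : Type*} [AddCommGroup G] {M : (G → ℝ) → ℝ}

/-- Doubling `t` doubles the mean of `x ↦ f (x + t) - f x`, while that function stays bounded. -/
lemma apply_translate_sub_le (hM : IsUpperMean G M) {f : G → ℝ} {C : ℝ}
    (hC : ∀ x, |f x| ≤ C) (n : ℕ) (t : G) :
    2 ^ n * M (fun x => f (x + t) - f x) ≤ 2 * C := by
  have hf : Bounded f := ⟨C, hC⟩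
  induction n generalizing t with
  | zero =>
    rw [pow_zero, one_mul, ← hM.norming (2 * C)]
    refine hM.mono _ _ ((hf.translate t).sub hf) (.const _) fun x => ?_
    linarith [le_of_abs_le (hC (x + t)), neg_le_of_abs_le (hC x)]
  | succ n ih =>
    have h := hM.restr_add _ ((hf.translate t).sub hf) t
    have heq : (fun x => f (x + t) - f x + (f (x + t + t) - f (x + t))) =
        fun x => f (x + (t + t)) - f x := by
      funext x
      rw [add_assoc]
      ring
    rw [heq] at h
    calc 2 ^ (n + 1) * M (fun x => f (x + t) - f x)
        = 2 ^ n * M (fun x => f (x + (t + t)) - f x) := by rw [h]; ring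
      _ ≤ 2 * C := ih (t + t)

lemma apply_translate_sub_nonpos (hM : IsUpperMean G M) {f : G → ℝ} (hf : Bounded f) (t : G) :
    M (fun x => f (x + t) - f x) ≤ 0 := by
  obtain ⟨C, hC⟩ := hf
  by_contra! h
  obtain ⟨n, hn⟩ := pow_unbounded_of_one_lt (2 * C / M fun x => f (x + t) - f x) one_lt_two
  rw [div_lt_iff₀ h] at hn
  exact hn.not_ge (hM.apply_translate_sub_le hC n t)

/-- Hahn–Banach: an upper mean dominates a linear functional on the bounded functions. -/
lemma exists_linear_le (hM : IsUpperMean G M) :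
    ∃ L : boundedSubmodule G →ₗ[ℝ] ℝ, ∀ f, L f ≤ M f := by
  obtain ⟨L, -, hL⟩ := exists_extension_of_le_sublinear
    (⊥ : boundedSubmodule G →ₗ.[ℝ] ℝ) (fun f => M f)
    (fun c hc f => hM.homog c hc.le f f.2) (fun f g => hM.subadd f g f.2 g.2) (by
      rintro ⟨x, hx⟩
      obtain rfl : x = 0 := hx
      exact (LinearMap.map_zero _).trans_le (hM.norming 0).ge)
  exact ⟨L, hL⟩

end IsUpperMean

/-- every upper mean admits a full mean squeezed between the conjugate lower
mean and the upper mean. -/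
theorem stmt3 {G : Type*} [AddCommGroup G] [Infinite G] (M : (G → ℝ) → ℝ)
    (hM : IsUpperMean G M) :
    ∃ M₁ : (G → ℝ) → ℝ, IsUpperMean G M₁ ∧ IsLowerMean G M₁ ∧
      (∀ f g : G → ℝ, Bounded f → Bounded g →
        M₁ (fun x => f x + g x) = M₁ f + M₁ g) ∧
      (∀ f : G → ℝ, Bounded f → -M (fun x => -f x) ≤ M₁ f ∧ M₁ f ≤ M f) := by
  classical
  obtain ⟨L, hL⟩ := hM.exists_linear_le
  set N : (G → ℝ) → ℝ := fun f => if h : Bounded f then L ⟨f, h⟩ else 0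
  have hN {f : G → ℝ} (h : Bounded f) : N f = L ⟨f, h⟩ := dif_pos h
  have le_upper (f : G → ℝ) (h : Bounded f) : N f ≤ M f := (hN h).trans_le (hL ⟨f, h⟩)
  have map_add (f g : G → ℝ) (hf : Bounded f) (hg : Bounded g) :
      N (fun x => f x + g x) = N f + N g := by
    rw [hN hf, hN hg, hN (hf.add hg), ← L.map_add]
    rfl
  have map_mul (c : ℝ) (f : G → ℝ) (hf : Bounded f) : N (fun x => c * f x) = c * N f := by
    rw [hN hf, hN (hf.const_mul c), ← smul_eq_mul, ← L.map_smul]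
    rfl
  have map_neg (f : G → ℝ) (hf : Bounded f) : N (fun x => -f x) = -N f := by
    simpa using map_mul (-1) f hf
  have map_sub (f g : G → ℝ) (hf : Bounded f) (hg : Bounded g) :
      N (fun x => f x - g x) = N f - N g := by
    simpa only [sub_eq_add_neg, map_neg g hg] using map_add f _ hf hg.neg
  have lower_le (f : G → ℝ) (h : Bounded f) : -M (fun x => -f x) ≤ N f := by
    linarith [le_upper _ h.neg, map_neg f h]
  have norming (c : ℝ) : N (fun _ => c) = c := by
    refine le_antisymm ((le_upper _ (.const c)).trans_eq (hM.norming c)) ?_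
    simpa [hM.norming] using lower_le _ (.const c)
  have mono (f g : G → ℝ) (hf : Bounded f) (hg : Bounded g) (h : ∀ x, f x ≤ g x) :
      N f ≤ N g := by
    have hsub := hM.mono _ _ (hf.sub hg) (.const 0) fun x => sub_nonpos.2 (h x)
    rw [hM.norming] at hsub
    linarith [le_upper _ (hf.sub hg), map_sub f g hf hg]
  have translate_le (f : G → ℝ) (hf : Bounded f) (t : G) : N (fun x => f (x + t)) ≤ N f := by
    linarith [le_upper _ ((hf.translate t).sub hf), map_sub _ f (hf.translate t) hf,
      hM.apply_translate_sub_nonpos hf t]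
  have map_translate (f : G → ℝ) (hf : Bounded f) (t : G) : N (fun x => f (x + t)) = N f := by
    refine le_antisymm (translate_le f hf t) ?_
    simpa using translate_le _ (hf.translate t) (-t)
  have restr_add (f : G → ℝ) (hf : Bounded f) (t : G) :
      N (fun x => f x + f (x + t)) = 2 * N f := by
    rw [map_add f _ hf (hf.translate t), map_translate f hf, two_mul]
  exact ⟨N,
    ⟨norming, mono, fun c _ => map_mul c, restr_add, fun f g hf hg => (map_add f g hf hg).le⟩,
    ⟨norming, mono, fun c _ => map_mul c, restr_add, fun f g hf hg => (map_add f g hf hg).ge⟩,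
    map_add, fun f hf => ⟨lower_le f hf, le_upper f hf⟩⟩
end

section
/- Let G be an infinite commutative group. Limit-commarginality of bounded functions on G is transitive (if f ∼ₗ f' and f' ∼ₗ f'' then f ∼ₗ f''), and it is compatible with every upper mean: if f ∼ₗ f', then M̄(f) = M̄(f') for every upper mean M̄ on G. -/
open scoped Pointwise BigOperators
open Filter

lemma Bounded.add_s8 {G : Type*} {f g : G → ℝ} (hf : Bounded f) (hg : Bounded g) :
    Bounded (fun x => f x + g x) := by
  obtain ⟨C, hC⟩ := hf
  obtain ⟨D, hD⟩ := hg
  exact ⟨C + D, fun x => (abs_add_le _ _).trans (add_le_add (hC x) (hD x))⟩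

lemma Bounded.sub_s8 {G : Type*} {f g : G → ℝ} (hf : Bounded f) (hg : Bounded g) :
    Bounded (fun x => f x - g x) := by
  obtain ⟨C, hC⟩ := hf
  obtain ⟨D, hD⟩ := hg
  exact ⟨C + D, fun x => (abs_sub _ _).trans (add_le_add (hC x) (hD x))⟩

lemma Bounded.comp {G H : Type*} {f : G → ℝ} (hf : Bounded f) (φ : H → G) :
    Bounded (fun x => f (φ x)) :=
  hf.imp fun _ hC x => hC (φ x)

lemma bounded_const {G : Type*} (c : ℝ) : Bounded (fun _ : G => c) :=
  ⟨|c|, fun _ => le_rfl⟩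

lemma Bounded.sum {G ι : Type*} (s : Finset ι) {h : ι → G → ℝ} (hh : ∀ i, Bounded (h i)) :
    Bounded (fun x => ∑ i ∈ s, h i x) := by
  classical
  induction s using Finset.induction_on with
  | empty => simpa using bounded_const 0
  | insert i s hi ih => simpa [Finset.sum_insert hi] using (hh i).add_s8 ih

section Commarginal

variable {G : Type*} [AddCommGroup G]

lemma Commarginal.symm {f f' : G → ℝ} (h : Commarginal f f') : Commarginal f' f := by
  classical
  obtain ⟨F, B, ⟨C, hC⟩, hB, hf, hf'⟩ := h
  refine ⟨fun x y => F y x, B.image Neg.neg, ⟨C, fun x y => hC y x⟩, fun x y hxy => ?_, hf', hf⟩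
  exact Finset.mem_image.mpr ⟨y - x, hB y x hxy, neg_sub y x⟩

/-- The first marginal of a commarginality witness sums its diagonals, the second one sums the
translated diagonals. -/
lemma Commarginal.exists_sum_translates {f f' : G → ℝ} (h : Commarginal f f') :
    ∃ (B : Finset G) (u : G → G → ℝ), (∀ b, Bounded (u b)) ∧
      (∀ x, f x = ∑ b ∈ B, u b x) ∧ (∀ x, f' x = ∑ b ∈ B, u b (x + b)) := by
  obtain ⟨F, B, ⟨C, hC⟩, hB, hf, hf'⟩ := h
  refine ⟨B, fun b x => F x (x - b), fun b => ⟨C, fun x => hC _ _⟩, fun x => ?_, fun y => ?_⟩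
  · rw [← hf x, ← finsum_comp_equiv (Equiv.subLeft x)]
    refine finsum_eq_sum_of_support_subset _ fun b hb => ?_
    simpa using hB _ _ hb
  · rw [← hf' y, ← finsum_comp_equiv (Equiv.addLeft y)]
    simp only [add_sub_cancel_right]
    refine finsum_eq_sum_of_support_subset _ fun b hb => ?_
    simpa using hB _ _ hb

lemma finite_support_left {F : G → G → ℝ} {B : Finset G} (hB : ∀ x y, F x y ≠ 0 → x - y ∈ B)
    (x : G) : (Function.support fun y => F x y).Finite :=
  (B.finite_toSet.image fun b => x - b).subset fun y hy => ⟨x - y, hB x y hy, by simp⟩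

lemma finite_support_right {F : G → G → ℝ} {B : Finset G} (hB : ∀ x y, F x y ≠ 0 → x - y ∈ B)
    (y : G) : (Function.support fun x => F x y).Finite :=
  (B.finite_toSet.image fun b => b + y).subset fun x hx => ⟨x - y, hB x y hx, by simp⟩

lemma Commarginal.add_s8 {f f' k k' : G → ℝ} (h₁ : Commarginal f f') (h₂ : Commarginal k k') :
    Commarginal (fun x => f x + k x) (fun x => f' x + k' x) := by
  classical
  obtain ⟨F, B, ⟨C, hC⟩, hB, hf, hf'⟩ := h₁
  obtain ⟨K, D, ⟨E, hE⟩, hD, hk, hk'⟩ := h₂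
  refine ⟨fun x y => F x y + K x y, B ∪ D,
    ⟨C + E, fun x y => (abs_add_le _ _).trans (add_le_add (hC x y) (hE x y))⟩,
    fun x y hxy => ?_, fun x => ?_, fun y => ?_⟩
  · by_cases hF : F x y = 0
    · exact Finset.mem_union_right _ (hD x y fun hK => hxy (by simp [hF, hK]))
    · exact Finset.mem_union_left _ (hB x y hF)
  · rw [finsum_add_distrib (finite_support_left hB x) (finite_support_left hD x), hf, hk]
  · rw [finsum_add_distrib (finite_support_right hB y) (finite_support_right hD y), hf', hk']

lemma Bounded.commarginal_self {f : G → ℝ} (hf : Bounded f) : Commarginal f f := by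
  classical
  obtain ⟨C, hC⟩ := hf
  refine ⟨fun x y => if x = y then f x else 0, {0}, ⟨C, fun x y => ?_⟩, fun x y hxy => ?_,
    fun x => ?_, fun y => ?_⟩
  · dsimp only
    split_ifs
    · exact hC x
    · simpa using (abs_nonneg _).trans (hC x)
  · have : x = y := by by_contra hne; simp [hne] at hxy
    simp [this]
  · rw [finsum_eq_single _ x fun y hy => if_neg hy.symm, if_pos rfl]
  · rw [finsum_eq_single _ y fun x hx => if_neg hx, if_pos rfl]

end Commarginal

lemma UnifLim.add_s8 {G : Type*} {g k : ℕ → G → ℝ} {f l : G → ℝ} (hg : UnifLim g f)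
    (hk : UnifLim k l) : UnifLim (fun n x => g n x + k n x) (fun x => f x + l x) := by
  intro ε hε
  obtain ⟨N, hN⟩ := hg (ε / 2) (half_pos hε)
  obtain ⟨K, hK⟩ := hk (ε / 2) (half_pos hε)
  refine ⟨max N K, fun n hn x => ?_⟩
  have h₁ := abs_lt.mp (hN n (le_of_max_le_left hn) x)
  have h₂ := abs_lt.mp (hK n (le_of_max_le_right hn) x)
  exact abs_lt.mpr ⟨by linarith, by linarith⟩

lemma UnifLim.neg {G : Type*} {g : ℕ → G → ℝ} {f : G → ℝ} (hg : UnifLim g f) :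
    UnifLim (fun n x => -g n x) (fun x => -f x) := by
  intro ε hε
  obtain ⟨N, hN⟩ := hg ε hε
  refine ⟨N, fun n hn x => ?_⟩
  rw [← abs_neg]
  convert hN n hn x using 2
  ring

lemma LimitCommarginal.trans {G : Type*} [AddCommGroup G] {f f' f'' : G → ℝ}
    (h₁ : LimitCommarginal f f') (h₂ : LimitCommarginal f' f'') : LimitCommarginal f f'' := by
  obtain ⟨g, g', hg, hg', hgg', hgf, hgf'⟩ := h₁
  obtain ⟨k, k', hk, hk', hkk', hkf, hkf'⟩ := h₂
  have hneg : ∀ n, Bounded (fun x => -k n x) := fun n =>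
    (hk n).imp fun C hC x => by simpa using hC x
  refine ⟨g, fun n x => g' n x + k' n x + -k n x, hg,
    fun n => ((hg' n).add_s8 (hk' n)).add_s8 (hneg n), fun n => ?_, hgf, ?_⟩
  · simpa using ((hgg' n).add_s8 (hkk' n)).add_s8 (hneg n).commarginal_self
  · simpa using (hgf'.add_s8 hkf').add_s8 hkf.neg

namespace IsUpperMean

variable {G : Type*} [AddCommGroup G] {M : (G → ℝ) → ℝ}

lemma le_of_forall_le (hM : IsUpperMean G M) {f : G → ℝ} (hf : Bounded f) {c : ℝ}
    (h : ∀ x, f x ≤ c) : M f ≤ c :=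
  (hM.mono f _ hf (bounded_const c) h).trans_eq (hM.norming c)

lemma le_add_sub (hM : IsUpperMean G M) {f g : G → ℝ} (hf : Bounded f) (hg : Bounded g) :
    M f ≤ M g + M (fun x => f x - g x) := by
  simpa using hM.subadd g _ hg (hf.sub_s8 hg)

lemma sum_le (hM : IsUpperMean G M) {ι : Type*} (s : Finset ι) {h : ι → G → ℝ}
    (hh : ∀ i, Bounded (h i)) : M (fun x => ∑ i ∈ s, h i x) ≤ ∑ i ∈ s, M (h i) := by
  classical
  induction s using Finset.induction_on with
  | empty => simpa using (hM.norming 0).le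
  | insert i s hi ih =>
    simp only [Finset.sum_insert hi]
    exact (hM.subadd _ _ (hh i) (Bounded.sum s hh)).trans (by gcongr)

lemma sub_translate_two_pow (hM : IsUpperMean G M) {h : G → ℝ} (hh : Bounded h) (t : G) (n : ℕ) :
    M (fun x => h x - h (x + 2 ^ n • t)) = 2 ^ n * M (fun x => h x - h (x + t)) := by
  induction n with
  | zero => simp
  | succ n ih =>
    rw [pow_succ' (2 : ℝ), mul_assoc, ← ih, ← hM.restr_add _ (hh.sub_s8 (hh.comp _)) (2 ^ n • t)]
    congr 1
    funext x
    rw [add_assoc, ← add_smul, ← two_mul, ← pow_succ']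
    ring

lemma sub_translate_le_zero (hM : IsUpperMean G M) {h : G → ℝ} (hh : Bounded h) (t : G) :
    M (fun x => h x - h (x + t)) ≤ 0 := by
  by_contra! hpos
  obtain ⟨C, hC⟩ := id hh
  obtain ⟨n, hn⟩ := pow_unbounded_of_one_lt (2 * C / M (fun x => h x - h (x + t))) one_lt_two
  rw [div_lt_iff₀ hpos, ← hM.sub_translate_two_pow hh] at hn
  refine hn.not_ge (hM.le_of_forall_le (hh.sub_s8 (hh.comp _)) fun x => ?_)
  linarith [(abs_le.mp (hC x)).2, (abs_le.mp (hC (x + 2 ^ n • t))).1]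

lemma le_of_commarginal (hM : IsUpperMean G M) {f f' : G → ℝ} (hf : Bounded f)
    (hf' : Bounded f') (h : Commarginal f f') : M f ≤ M f' := by
  obtain ⟨B, u, hu, hfu, hfu'⟩ := h.exists_sum_translates
  have hdiff : M (fun x => f x - f' x) ≤ 0 := by
    simp only [hfu, hfu', ← Finset.sum_sub_distrib]
    exact (hM.sum_le B fun b => (hu b).sub_s8 ((hu b).comp (· + b))).trans
      (Finset.sum_nonpos fun b _ => hM.sub_translate_le_zero (hu b) b)
  linarith [hM.le_add_sub hf hf']

lemma le_of_limitCommarginal (hM : IsUpperMean G M) {f f' : G → ℝ} (hf : Bounded f)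
    (hf' : Bounded f') (h : LimitCommarginal f f') : M f ≤ M f' := by
  obtain ⟨g, g', hg, hg', hgg', hgf, hgf'⟩ := h
  refine le_of_forall_pos_le_add fun ε hε => ?_
  obtain ⟨N, hN⟩ := hgf (ε / 2) (half_pos hε)
  obtain ⟨K, hK⟩ := hgf' (ε / 2) (half_pos hε)
  set n := max N K
  have h₁ : M (fun x => f x - g n x) ≤ ε / 2 := hM.le_of_forall_le (hf.sub_s8 (hg n)) fun x => by
    linarith [(abs_lt.mp (hN n (le_max_left _ _) x)).1]
  have h₂ : M (fun x => g' n x - f' x) ≤ ε / 2 := hM.le_of_forall_le ((hg' n).sub_s8 hf') fun x =>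
    (abs_lt.mp (hK n (le_max_right _ _) x)).2.le
  linarith [hM.le_add_sub hf (hg n), hM.le_of_commarginal (hg n) (hg' n) (hgg' n),
    hM.le_add_sub (hg' n) hf']

end IsUpperMean

lemma LimitCommarginal.symm {G : Type*} [AddCommGroup G] {f f' : G → ℝ}
    (h : LimitCommarginal f f') : LimitCommarginal f' f := by
  obtain ⟨g, g', hg, hg', hgg', hgf, hgf'⟩ := h
  exact ⟨g', g, hg', hg, fun n => (hgg' n).symm, hgf', hgf⟩

/-- limit-commarginality is transitive and compatible with every upper mean. -/
theorem stmt8 {G : Type*} [AddCommGroup G] [Infinite G] :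
    (∀ f f' f'' : G → ℝ, Bounded f → Bounded f' → Bounded f'' →
      LimitCommarginal f f' → LimitCommarginal f' f'' → LimitCommarginal f f'') ∧
    (∀ f f' : G → ℝ, Bounded f → Bounded f' → LimitCommarginal f f' →
      ∀ M : (G → ℝ) → ℝ, IsUpperMean G M → M f = M f') := by
  exact ⟨fun _ _ _ _ _ _ h₁ h₂ => h₁.trans h₂, fun _ _ hf hf' h _ hM =>
    (hM.le_of_limitCommarginal hf hf' h).antisymm (hM.le_of_limitCommarginal hf' hf h.symm)⟩
end

section
/- Let G be an infinite commutative group. For every bounded function f : G → ℝ, M*(f) = inf over finite nonempty B ⊆ G of sup_{t∈G} (f|B)(t), and M_*(f) = sup over finite nonempty B ⊆ G of inf_{t∈G} (f|B)(t). -/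
open scoped Pointwise BigOperators
open Filter

/-- The sums `∑ i, k i • t i` with coefficients `k i < n`. -/
def boxSums {G ι : Type*} [AddCommGroup G] [DecidableEq G] [Fintype ι] [DecidableEq ι]
    (t : ι → G) (n : ℕ) : Finset G :=
  (Fintype.piFinset fun _ : ι => Finset.range n).image fun k => ∑ i, k i • t i

section BoxSums

variable {G ι : Type*} [AddCommGroup G] [DecidableEq G] [Fintype ι] [DecidableEq ι]

lemma mem_boxSums {t : ι → G} {n : ℕ} {x : G} :
    x ∈ boxSums t n ↔ ∃ k : ι → ℕ, (∀ i, k i < n) ∧ ∑ i, k i • t i = x := by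
  simp [boxSums]

lemma card_boxSums_le (t : ι → G) (n : ℕ) : (boxSums t n).card ≤ n ^ Fintype.card ι :=
  Finset.card_image_le.trans (by simp)

lemma boxSums_subset_succ (t : ι → G) (n : ℕ) : boxSums t n ⊆ boxSums t (n + 1) := by
  intro x hx
  obtain ⟨k, hk, rfl⟩ := mem_boxSums.1 hx
  exact mem_boxSums.2 ⟨k, fun i => (hk i).trans n.lt_succ_self, rfl⟩

lemma add_mem_boxSums_succ {t : ι → G} {n : ℕ} {x : G} (hx : x ∈ boxSums t n) (i : ι) :
    x + t i ∈ boxSums t (n + 1) := by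
  obtain ⟨k, hk, rfl⟩ := mem_boxSums.1 hx
  refine mem_boxSums.2 ⟨k + Pi.single i 1, fun j => ?_, ?_⟩
  · have := hk j
    by_cases h : j = i
    · subst h; simp; omega
    · simp [h]; omega
  · simp only [Pi.add_apply, add_smul, Finset.sum_add_distrib]
    congr 1
    rw [Finset.sum_eq_single i] <;> simp +contextual

lemma boxSums_nonempty (t : ι → G) (n : ℕ) : (boxSums t (n + 1)).Nonempty :=
  ⟨0, mem_boxSums.2 ⟨0, by simp, by simp⟩⟩

/-- Polynomial growth forces some box to be nearly as large as the next one. -/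
lemma exists_card_boxSums_succ_le (t : ι → G) {ε : ℝ} (hε : 0 < ε) :
    ∃ n, (boxSums t n).Nonempty ∧
      ((boxSums t (n + 1)).card : ℝ) ≤ (1 + ε) * (boxSums t n).card := by
  by_contra! h
  have growth : ∀ n : ℕ, (1 + ε) ^ n ≤ ((boxSums t (n + 1)).card : ℝ) := by
    intro n
    induction n with
    | zero => simpa using (boxSums_nonempty t 0).card_pos
    | succ n ih =>
      have h₁ := h (n + 1) (boxSums_nonempty t n)
      rw [pow_succ']
      exact (mul_le_mul_of_nonneg_left ih (by positivity)).trans h₁.le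
  have lim := tendsto_pow_const_div_const_pow_of_one_lt (Fintype.card ι)
    (show 1 < 1 + ε by linarith)
  have lim' := lim.comp (tendsto_add_atTop_nat 1)
  obtain ⟨n, hn⟩ := (lim'.eventually_lt_const
    (show (0 : ℝ) < (1 + ε)⁻¹ by positivity)).exists
  have hcard : ((boxSums t (n + 1)).card : ℝ) ≤ ((n + 1 : ℕ) : ℝ) ^ Fintype.card ι := by
    exact_mod_cast card_boxSums_le t (n + 1)
  have hpos : (0 : ℝ) < (1 + ε) ^ n := by positivity
  have hle := (growth n).trans hcard
  simp only [Function.comp_apply] at hn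
  rw [div_lt_iff₀ (by positivity), pow_succ', inv_mul_cancel_left₀ (by positivity)] at hn
  linarith

end BoxSums

section Means

variable {G : Type*} [AddCommGroup G]

lemma abs_sum_sub_sum_le {α : Type*} {f : α → ℝ} {C : ℝ} (hC : ∀ x, |f x| ≤ C) {A B : Finset α}
    (h : A ⊆ B) : |∑ b ∈ B, f b - ∑ b ∈ A, f b| ≤ C * ((B.card : ℝ) - A.card) := by
  classical
  rw [← Finset.sum_sdiff h, add_sub_cancel_right]
  calc |∑ b ∈ B \ A, f b| ≤ ∑ b ∈ B \ A, |f b| := Finset.abs_sum_le_sum_abs _ _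
    _ ≤ (B \ A).card • C := Finset.sum_le_card_nsmul _ _ _ fun x _ => hC x
    _ = C * ((B.card : ℝ) - A.card) := by
      rw [Finset.card_sdiff_of_subset h, nsmul_eq_mul, Nat.cast_sub (Finset.card_le_card h),
        mul_comm]

/-- Averages over suitable finite sets are almost invariant under finitely many translations. -/
lemma exists_abs_avg_add_sub_avg_le {ι : Type*} [Fintype ι] {f : G → ℝ} (hf : Bounded f)
    (t : ι → G) {ε : ℝ} (hε : 0 < ε) :
    ∃ B : Finset G, B.Nonempty ∧ ∀ i x, |avg f B (x + t i) - avg f B x| ≤ ε := by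
  classical
  obtain ⟨C, hC⟩ := hf
  have hC₀ : 0 ≤ C := (abs_nonneg _).trans (hC 0)
  obtain ⟨n, hne, hn⟩ := exists_card_boxSums_succ_le t
    (show 0 < ε / (2 * (C + 1)) by positivity)
  refine ⟨boxSums t n, hne, fun i x => ?_⟩
  have hpos : (0 : ℝ) < (boxSums t n).card := by exact_mod_cast hne.card_pos
  have hshift : (boxSums t n).map (addRightEmbedding (t i)) ⊆ boxSums t (n + 1) := by
    intro y hy
    obtain ⟨b, hb, rfl⟩ := Finset.mem_map.1 hy
    exact add_mem_boxSums_succ hb i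
  have h₁ := abs_sum_sub_sum_le (fun y => hC (y + x)) hshift
  have h₂ := abs_sum_sub_sum_le (fun y => hC (y + x)) (boxSums_subset_succ t n)
  rw [Finset.card_map, Finset.sum_map] at h₁
  have hsum : ∀ b, f (addRightEmbedding (t i) b + x) = f (b + (x + t i)) := fun b => by
    rw [addRightEmbedding_apply, add_assoc, add_comm (t i)]
  simp only [hsum] at h₁
  rw [avg, avg, ← sub_div, abs_div, abs_of_pos hpos, div_le_iff₀ hpos]
  have hdiff : C * (((boxSums t (n + 1)).card : ℝ) - (boxSums t n).card) ≤
      ε / 2 * (boxSums t n).card := by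
    have h₃ : ((boxSums t (n + 1)).card : ℝ) - (boxSums t n).card ≤
        ε / (2 * (C + 1)) * (boxSums t n).card := by linarith
    calc _ ≤ (C + 1) * (ε / (2 * (C + 1)) * (boxSums t n).card) := by
          have h₄ : (0 : ℝ) ≤ ((boxSums t (n + 1)).card : ℝ) - (boxSums t n).card :=
            sub_nonneg.2 (by exact_mod_cast Finset.card_le_card (boxSums_subset_succ t n))
          gcongr; linarith
      _ = _ := by field_simp
  rw [abs_le] at h₁ h₂ ⊢
  constructor <;> linarith [h₁.1, h₁.2, h₂.1, h₂.2]

lemma ConvexCombTranslates.abs_le {f g : G → ℝ} (h : ConvexCombTranslates f g) {C : ℝ}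
    (hC : ∀ x, |f x| ≤ C) (x : G) : |g x| ≤ C := by
  obtain ⟨n, c, t, hc, hsum, hg⟩ := h
  rw [hg]
  calc |∑ i, c i * f (x + t i)| ≤ ∑ i, |c i * f (x + t i)| := Finset.abs_sum_le_sum_abs _ _
    _ ≤ ∑ i, c i * C := Finset.sum_le_sum fun i _ => by
      rw [abs_mul, abs_of_nonneg (hc i)]
      exact mul_le_mul_of_nonneg_left (hC _) (hc i)
    _ = C := by rw [← Finset.sum_mul, hsum, one_mul]

lemma convexCombTranslates_avg (f : G → ℝ) {B : Finset G} (hB : B.Nonempty) :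
    ConvexCombTranslates f (avg f B) := by
  have hpos : (0 : ℝ) < B.card := by exact_mod_cast hB.card_pos
  refine ⟨B.card, fun _ => (B.card : ℝ)⁻¹, fun i => (B.equivFin.symm i : G),
    fun _ => by positivity, by simp [hpos.ne'], fun x => ?_⟩
  rw [avg, ← Finset.mul_sum, div_eq_inv_mul, ← Finset.sum_coe_sort B,
    ← B.equivFin.symm.sum_comp]
  simp only [add_comm]

lemma avg_le {g : G → ℝ} {s : ℝ} (hg : ∀ x, g x ≤ s) {B : Finset G} (hB : B.Nonempty) (x : G) :
    avg g B x ≤ s := by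
  have hpos : (0 : ℝ) < B.card := by exact_mod_cast hB.card_pos
  rw [avg, div_le_iff₀ hpos, mul_comm, ← nsmul_eq_mul]
  exact Finset.sum_le_card_nsmul _ _ _ fun b _ => hg _

/-- A convex combination of translates is dominated, on average, by averages over finite sets. -/
lemma ConvexCombTranslates.exists_avg_le {f g : G → ℝ} (hf : Bounded f)
    (h : ConvexCombTranslates f g) {s ε : ℝ} (hg : ∀ x, g x ≤ s) (hε : 0 < ε) :
    ∃ B : Finset G, B.Nonempty ∧ ∀ x, avg f B x ≤ s + ε := by
  obtain ⟨n, c, t, hc, hsum, hgx⟩ := h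
  obtain ⟨B, hB, hinv⟩ := exists_abs_avg_add_sub_avg_le hf t hε
  refine ⟨B, hB, fun x => ?_⟩
  have havg : avg g B x = ∑ i, c i * avg f B (x + t i) := by
    simp only [avg, hgx, ← mul_div_assoc, ← Finset.sum_div]
    rw [Finset.sum_comm]
    simp only [Finset.mul_sum, add_assoc]
  have hle : avg f B x - ε ≤ avg g B x := by
    calc avg f B x - ε = ∑ i, c i * (avg f B x - ε) := by rw [← Finset.sum_mul, hsum, one_mul]
      _ ≤ ∑ i, c i * avg f B (x + t i) := Finset.sum_le_sum fun i _ =>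
        mul_le_mul_of_nonneg_left (by linarith [(_root_.abs_le.1 (hinv i x)).1]) (hc i)
      _ = avg g B x := havg.symm
  linarith [avg_le hg hB x]

lemma Mstar_eq_iInf_iSup_avg {f : G → ℝ} (hf : Bounded f) :
    Mstar f = ⨅ B : {B : Finset G // B.Nonempty}, ⨆ t : G, avg f B.1 t := by
  have hf' := hf
  obtain ⟨C, hC⟩ := hf'
  have hbdd : ∀ g, ConvexCombTranslates f g → BddAbove (Set.range g) := by
    rintro g hg
    exact ⟨C, Set.forall_mem_range.2 fun x => (_root_.abs_le.1 (hg.abs_le hC x)).2⟩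
  have hlow : ∀ g, ConvexCombTranslates f g → -C ≤ sSup (Set.range g) := fun g hg =>
    (_root_.abs_le.1 (hg.abs_le hC 0)).1.trans (le_csSup (hbdd g hg) ⟨0, rfl⟩)
  have : Nonempty {B : Finset G // B.Nonempty} := ⟨⟨{0}, by simp⟩⟩
  apply le_antisymm
  · refine le_ciInf fun B => csInf_le ⟨-C, ?_⟩ ⟨_, convexCombTranslates_avg f B.2, rfl⟩
    rintro _ ⟨g, hg, rfl⟩
    exact hlow g hg
  · refine le_csInf ⟨_, _, convexCombTranslates_avg f (Finset.singleton_nonempty 0), rfl⟩ ?_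
    rintro _ ⟨g, hg, rfl⟩
    refine le_of_forall_pos_le_add fun ε hε => ?_
    obtain ⟨B, hB, hle⟩ := hg.exists_avg_le hf (fun x => le_csSup (hbdd g hg) ⟨x, rfl⟩) hε
    refine (ciInf_le ⟨-C, ?_⟩ ⟨B, hB⟩).trans (ciSup_le hle)
    rintro _ ⟨B, rfl⟩
    exact hlow _ (convexCombTranslates_avg f B.2)

lemma ConvexCombTranslates.neg {f g : G → ℝ} (h : ConvexCombTranslates f g) :
    ConvexCombTranslates (-f) (-g) := by
  obtain ⟨n, c, t, hc, hsum, hg⟩ := h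
  exact ⟨n, c, t, hc, hsum, fun x => by simp [hg]⟩

lemma avg_neg (f : G → ℝ) (B : Finset G) (t : G) : avg (-f) B t = -avg f B t := by
  simp [avg, neg_div]

lemma sSup_range_neg {α : Type*} (g : α → ℝ) : sSup (Set.range (-g)) = -sInf (Set.range g) := by
  rw [← Real.sSup_neg, ← Set.image_neg_eq_neg, ← Set.range_comp]
  rfl

lemma Mlowstar_eq_neg_Mstar_neg (f : G → ℝ) : Mlowstar f = -Mstar (-f) := by
  rw [Mstar, Real.sInf_def, neg_neg, Mlowstar]
  congr 1
  ext a
  simp only [Set.mem_ofPred_eq, Set.mem_neg]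
  constructor
  · rintro ⟨g, hg, rfl⟩
    exact ⟨-g, hg.neg, (sSup_range_neg g).symm⟩
  · rintro ⟨g, hg, ha⟩
    refine ⟨-g, by simpa using hg.neg, ?_⟩
    rw [← neg_inj, ← sSup_range_neg, neg_neg, ha]

end Means

/-- for every bounded `f`, `M*(f)` is the inf over finite nonempty `B` of
`sup_t (f|B)(t)`, and `M_*(f)` is the sup over `B` of `inf_t (f|B)(t)`. -/
theorem stmt12 {G : Type*} [AddCommGroup G] [Infinite G]
    (f : G → ℝ) (hf : Bounded f) :
    Mstar f = (⨅ B : {B : Finset G // B.Nonempty}, ⨆ t : G, avg f B.1 t) ∧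
    Mlowstar f = (⨆ B : {B : Finset G // B.Nonempty}, ⨅ t : G, avg f B.1 t) := by
  refine ⟨Mstar_eq_iInf_iSup_avg hf, ?_⟩
  have hneg : Bounded (-f) := hf.imp fun C hC x => by simpa using hC x
  have hinner : ∀ B : Finset G, ⨆ t, avg (-f) B t = -⨅ t, avg f B t := fun B => by
    rw [iInf, ← sSup_range_neg]
    exact congrArg sSup (congrArg Set.range (funext (avg_neg f B)))
  rw [Mlowstar_eq_neg_Mstar_neg, Mstar_eq_iInf_iSup_avg hneg]
  simp only [hinner]
  rw [iInf, Real.sInf_def, neg_neg, ← Set.image_neg_eq_neg, ← Set.range_comp, iSup]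
  simp only [Function.comp_def, neg_neg]
end
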